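/- Let A₁, B₁ ∈ ℂ^{n×n}, let i, k be positive integers, suppose the AB-algorithm is breakdown-free up to step max(i,k), and let U ∈ ℂ^{n×m} and Λ ∈ ℂ^{m×m} satisfy A₁ U = B₁ U Λ. Then A_i U (∑_{j=1}^{i} Λ^j) = B_k U Λ^i (∑_{j=1}^{k} Λ^j). -/

import Mathlib

open Matrix BigOperators

/-- The parallel-sum identity `X (X + Y)⁻¹ Y = Y (X + Y)⁻¹ X`. -/
theorem Matrix.mul_inv_add_mul_comm {ι R : Type*} [Fintype ι] [DecidableEq ι] [CommRing R]
    {X Y : Matrix ι ι R} (h : IsUnit (X + Y)) :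
    X * (X + Y)⁻¹ * Y = Y * (X + Y)⁻¹ * X := by
  have hdet := (Matrix.isUnit_iff_isUnit_det _).1 h
  calc X * (X + Y)⁻¹ * Y = X * ((X + Y)⁻¹ * (X + Y)) - X * (X + Y)⁻¹ * X := by noncomm_ring
    _ = (X + Y) * (X + Y)⁻¹ * X - X * (X + Y)⁻¹ * X := by
      rw [Matrix.nonsing_inv_mul _ hdet, Matrix.mul_nonsing_inv _ hdet, mul_one, one_mul]
    _ = Y * (X + Y)⁻¹ * X := by noncomm_ring

section ABAlgorithm

variable {ι κ R : Type*} [Fintype ι] [DecidableEq ι] [Fintype κ] [DecidableEq κ] [CommRing R]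
  {A B : ℕ → Matrix ι ι R} {U : Matrix ι κ R} {Λ : Matrix κ κ R} {k : ℕ}

/-- The iterates of the AB-algorithm satisfy `A_k U = B_k U Λ^k`. -/
theorem ab_algorithm_deflating_subspace
    (hrecA : ∀ j, 1 ≤ j → A (j + 1) = A 1 * (A 1 + B j)⁻¹ * A j)
    (hrecB : ∀ j, 1 ≤ j → B (j + 1) = B j * (A 1 + B j)⁻¹ * B 1)
    (hk : 1 ≤ k) (hinv : ∀ j, 1 ≤ j → j < k → IsUnit (A 1 + B j))
    (hU : A 1 * U = B 1 * U * Λ) :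
    A k * U = B k * U * Λ ^ k := by
  induction k, hk using Nat.le_induction with
  | base => simpa using hU
  | succ k hk ih =>
    have ih := ih fun j hj hjk => hinv j hj (by omega)
    calc A (k + 1) * U = A 1 * (A 1 + B k)⁻¹ * (A k * U) := by
          rw [hrecA k hk, Matrix.mul_assoc]
      _ = A 1 * (A 1 + B k)⁻¹ * B k * U * Λ ^ k := by rw [ih]; simp only [Matrix.mul_assoc]
      _ = B k * (A 1 + B k)⁻¹ * (A 1 * U) * Λ ^ k := by
          rw [Matrix.mul_inv_add_mul_comm (hinv k hk (by omega))]; simp only [Matrix.mul_assoc]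
      _ = B (k + 1) * U * Λ ^ (k + 1) := by
          rw [hU, hrecB k hk, pow_succ']; simp only [Matrix.mul_assoc]

/-- The iterates `B_k` of the AB-algorithm satisfy `B_k U (∑_{j=1}^k Λ^j) = A₁ U`. -/
theorem ab_algorithm_mul_sum_pow
    (hrecB : ∀ j, 1 ≤ j → B (j + 1) = B j * (A 1 + B j)⁻¹ * B 1)
    (hk : 1 ≤ k) (hinv : ∀ j, 1 ≤ j → j < k → IsUnit (A 1 + B j))
    (hU : A 1 * U = B 1 * U * Λ) :
    B k * U * ∑ j ∈ Finset.Icc 1 k, Λ ^ j = A 1 * U := by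
  induction k, hk using Nat.le_induction with
  | base => simpa using hU.symm
  | succ k hk ih =>
    have ih := ih fun j hj hjk => hinv j hj (by omega)
    have hunit := hinv k hk (by omega)
    have hsum : ∑ j ∈ Finset.Icc 1 (k + 1), Λ ^ j
        = Λ * (1 + ∑ j ∈ Finset.Icc 1 k, Λ ^ j) := by
      simp only [← Finset.Ico_add_one_right_eq_Icc, Finset.sum_Ico_eq_sum_range,
        Nat.add_sub_cancel, Finset.sum_range_succ', mul_add, Finset.mul_sum, ← pow_succ']
      simp [add_comm]
    calc B (k + 1) * U * ∑ j ∈ Finset.Icc 1 (k + 1), Λ ^ j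
        = B k * (A 1 + B k)⁻¹ * (B 1 * U * Λ) * (1 + ∑ j ∈ Finset.Icc 1 k, Λ ^ j) := by
          rw [hrecB k hk, hsum]; simp only [Matrix.mul_assoc]
      _ = B k * (A 1 + B k)⁻¹ * A 1 * U * (1 + ∑ j ∈ Finset.Icc 1 k, Λ ^ j) := by
          rw [← hU]; simp only [Matrix.mul_assoc]
      _ = A 1 * (A 1 + B k)⁻¹ * (B k * U + B k * U * ∑ j ∈ Finset.Icc 1 k, Λ ^ j) := by
          rw [← Matrix.mul_inv_add_mul_comm hunit]
          simp only [Matrix.mul_assoc, Matrix.mul_add, Matrix.mul_one]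
      _ = A 1 * ((A 1 + B k)⁻¹ * (A 1 + B k)) * U := by
          rw [ih, add_comm, ← Matrix.add_mul]; simp only [Matrix.mul_assoc]
      _ = A 1 * U := by
          rw [Matrix.nonsing_inv_mul _ ((Matrix.isUnit_iff_isUnit_det _).1 hunit), mul_one]

end ABAlgorithm

/-- If `A₁ U = B₁ U Λ` and the AB-algorithm is breakdown-free up to step
`max i k`, then `A_i U (∑_{j=1}^i Λ^j) = B_k U Λ^i (∑_{j=1}^k Λ^j)`. -/
theorem ab_algorithm_deflating_subspace_mixed (n m : ℕ) (hn : 0 < n)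
    (A B : ℕ → Matrix (Fin n) (Fin n) ℂ)
    (hrecA : ∀ j, 1 ≤ j → A (j + 1) = A 1 * (A 1 + B j)⁻¹ * A j)
    (hrecB : ∀ j, 1 ≤ j → B (j + 1) = B j * (A 1 + B j)⁻¹ * B 1)
    (i k : ℕ) (hi : 1 ≤ i) (hk : 1 ≤ k)
    (hinv : ∀ j, 1 ≤ j → j < max i k → IsUnit (A 1 + B j))
    (U : Matrix (Fin n) (Fin m) ℂ) (Λ : Matrix (Fin m) (Fin m) ℂ)
    (hU : A 1 * U = B 1 * U * Λ) :
    A i * U * ∑ j ∈ Finset.Icc 1 i, Λ ^ j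
      = B k * U * Λ ^ i * ∑ j ∈ Finset.Icc 1 k, Λ ^ j := by
  have hcomm (l : ℕ) : Λ ^ i * ∑ j ∈ Finset.Icc 1 l, Λ ^ j
      = (∑ j ∈ Finset.Icc 1 l, Λ ^ j) * Λ ^ i :=
    Commute.sum_right _ _ _ fun j _ => Commute.pow_pow_self Λ i j
  have hinvi : ∀ j, 1 ≤ j → j < i → IsUnit (A 1 + B j) := fun j hj hji =>
    hinv j hj (lt_max_of_lt_left hji)
  have hinvk : ∀ j, 1 ≤ j → j < k → IsUnit (A 1 + B j) := fun j hj hjk =>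
    hinv j hj (lt_max_of_lt_right hjk)
  rw [ab_algorithm_deflating_subspace hrecA hrecB hi hinvi hU, Matrix.mul_assoc _ (Λ ^ i),
    Matrix.mul_assoc _ (Λ ^ i), hcomm, hcomm, ← Matrix.mul_assoc, ← Matrix.mul_assoc,
    ab_algorithm_mul_sum_pow hrecB hi hinvi hU, ab_algorithm_mul_sum_pow hrecB hk hinvk hU]
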